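/- arXiv:1608.05114 — 2 statements merged into one kernel-verified Lean document; each statement's English description precedes it below -/
import Mathlib

section
/- Let Ω = ℝ × (0, ∞) and define F : Ω → ℝ by F(x, y) = x / (x² + (y + 1)²). Then F is smooth on Ω, F is harmonic on Ω (i.e., ∂²F/∂x² + ∂²F/∂y² = 0 everywhere on Ω), and 0 < ∫_Ω ((∂F/∂x)² + (∂F/∂y)²) dx dy < ∞. -/
open MeasureTheory

/-- Partial derivative in the `x`-direction of a function on `ℝ × ℝ`. -/
noncomputable def pdx (F : ℝ × ℝ → ℝ) (q : ℝ × ℝ) : ℝ := fderiv ℝ F q (1, 0)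

/-- Partial derivative in the `y`-direction of a function on `ℝ × ℝ`. -/
noncomputable def pdy (F : ℝ × ℝ → ℝ) (q : ℝ × ℝ) : ℝ := fderiv ℝ F q (0, 1)

theorem pdx_eq_of_hasDerivAt {F : ℝ × ℝ → ℝ} {q : ℝ × ℝ} {d : ℝ} (hF : DifferentiableAt ℝ F q)
    (h : HasDerivAt (fun t => F (t, q.2)) d q.1) : pdx F q = d := by
  have hline : HasDerivAt (fun t : ℝ => (t, q.2)) ((1 : ℝ), (0 : ℝ)) q.1 :=
    (hasDerivAt_id _).prodMk (hasDerivAt_const _ _)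
  exact (hF.hasFDerivAt.comp_hasDerivAt q.1 hline).unique h

theorem pdy_eq_of_hasDerivAt {F : ℝ × ℝ → ℝ} {q : ℝ × ℝ} {d : ℝ} (hF : DifferentiableAt ℝ F q)
    (h : HasDerivAt (fun t => F (q.1, t)) d q.2) : pdy F q = d := by
  have hline : HasDerivAt (fun t : ℝ => (q.1, t)) ((0 : ℝ), (1 : ℝ)) q.2 :=
    (hasDerivAt_const _ _).prodMk (hasDerivAt_id _)
  exact (hF.hasFDerivAt.comp_hasDerivAt q.2 hline).unique h

theorem Filter.EventuallyEq.pdx_eq {F G : ℝ × ℝ → ℝ} {q : ℝ × ℝ} (h : F =ᶠ[nhds q] G) :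
    pdx F q = pdx G q := by
  rw [pdx, pdx, h.fderiv_eq]

theorem Filter.EventuallyEq.pdy_eq {F G : ℝ × ℝ → ℝ} {q : ℝ × ℝ} (h : F =ᶠ[nhds q] G) :
    pdy F q = pdy G q := by
  rw [pdy, pdy, h.fderiv_eq]

theorem hasDerivAt_sq_add_const (a x : ℝ) : HasDerivAt (fun t : ℝ => t ^ 2 + a) (2 * x) x := by
  simpa using (hasDerivAt_pow 2 x).add_const a

theorem hasDerivAt_const_add_add_one_sq (a y : ℝ) :
    HasDerivAt (fun t : ℝ => a + (t + 1) ^ 2) (2 * (y + 1)) y := by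
  simpa using (((hasDerivAt_id y).add_const 1).pow 2).const_add a

/-- The squared Euclidean distance to `(0, -1)`. -/
def poleDistSq (q : ℝ × ℝ) : ℝ := q.1 ^ 2 + (q.2 + 1) ^ 2

theorem poleDistSq_pos {q : ℝ × ℝ} (hq : 0 < q.2) : 0 < poleDistSq q := by
  unfold poleDistSq; positivity

theorem contDiff_poleDistSq {n : WithTop ℕ∞} : ContDiff ℝ n poleDistSq := by
  unfold poleDistSq; fun_prop

@[fun_prop]
theorem differentiable_poleDistSq : Differentiable ℝ poleDistSq :=
  contDiff_poleDistSq.differentiable one_ne_zero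

theorem pdx_div_poleDistSq {q : ℝ × ℝ} (hq : poleDistSq q ≠ 0) :
    pdx (fun p => p.1 / poleDistSq p) q = ((q.2 + 1) ^ 2 - q.1 ^ 2) / poleDistSq q ^ 2 := by
  refine pdx_eq_of_hasDerivAt (by fun_prop (disch := assumption)) ?_
  refine HasDerivAt.congr_deriv ((hasDerivAt_id q.1).fun_div
    (hasDerivAt_sq_add_const ((q.2 + 1) ^ 2) q.1) hq) ?_
  simp only [poleDistSq, id]
  ring

theorem pdy_div_poleDistSq {q : ℝ × ℝ} (hq : poleDistSq q ≠ 0) :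
    pdy (fun p => p.1 / poleDistSq p) q = -(2 * q.1 * (q.2 + 1)) / poleDistSq q ^ 2 := by
  refine pdy_eq_of_hasDerivAt (by fun_prop (disch := assumption)) ?_
  refine HasDerivAt.congr_deriv ((hasDerivAt_const q.2 q.1).fun_div
    (hasDerivAt_const_add_add_one_sq (q.1 ^ 2) q.2) hq) ?_
  simp only [poleDistSq]
  ring

theorem pdx_pdx_div_poleDistSq {q : ℝ × ℝ} (hq : poleDistSq q ≠ 0) :
    pdx (pdx fun p => p.1 / poleDistSq p) q =
      (2 * q.1 ^ 3 - 6 * q.1 * (q.2 + 1) ^ 2) / poleDistSq q ^ 3 := by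
  have hev : pdx (fun p => p.1 / poleDistSq p) =ᶠ[nhds q]
      fun p => ((p.2 + 1) ^ 2 - p.1 ^ 2) / poleDistSq p ^ 2 := by
    filter_upwards [(differentiable_poleDistSq q).continuousAt.eventually_ne hq] with p hp
    exact pdx_div_poleDistSq hp
  rw [hev.pdx_eq]
  refine pdx_eq_of_hasDerivAt (by fun_prop (disch := exact pow_ne_zero 2 hq)) ?_
  refine HasDerivAt.congr_deriv (((hasDerivAt_pow 2 q.1).const_sub ((q.2 + 1) ^ 2)).fun_div
    ((hasDerivAt_sq_add_const ((q.2 + 1) ^ 2) q.1).fun_pow 2) (pow_ne_zero 2 hq)) ?_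
  simp only [poleDistSq] at hq ⊢
  field_simp
  push_cast
  ring

theorem pdy_pdy_div_poleDistSq {q : ℝ × ℝ} (hq : poleDistSq q ≠ 0) :
    pdy (pdy fun p => p.1 / poleDistSq p) q =
      (6 * q.1 * (q.2 + 1) ^ 2 - 2 * q.1 ^ 3) / poleDistSq q ^ 3 := by
  have hev : pdy (fun p => p.1 / poleDistSq p) =ᶠ[nhds q]
      fun p => -(2 * p.1 * (p.2 + 1)) / poleDistSq p ^ 2 := by
    filter_upwards [(differentiable_poleDistSq q).continuousAt.eventually_ne hq] with p hp
    exact pdy_div_poleDistSq hp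
  rw [hev.pdy_eq]
  refine pdy_eq_of_hasDerivAt (by fun_prop (disch := exact pow_ne_zero 2 hq)) ?_
  refine HasDerivAt.congr_deriv
    (((((hasDerivAt_id q.2).add_const 1).const_mul (2 * q.1)).fun_neg).fun_div
      ((hasDerivAt_const_add_add_one_sq (q.1 ^ 2) q.2).fun_pow 2) (pow_ne_zero 2 hq)) ?_
  simp only [poleDistSq, id] at hq ⊢
  field_simp
  push_cast
  ring

theorem pdx_sq_add_pdy_sq_div_poleDistSq {q : ℝ × ℝ} (hq : poleDistSq q ≠ 0) :
    pdx (fun p => p.1 / poleDistSq p) q ^ 2 + pdy (fun p => p.1 / poleDistSq p) q ^ 2 =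
      (poleDistSq q ^ 2)⁻¹ := by
  rw [pdx_div_poleDistSq hq, pdy_div_poleDistSq hq]
  field_simp
  simp only [poleDistSq]
  ring

theorem measurableSet_upperHalfPlane : MeasurableSet {q : ℝ × ℝ | 0 < q.2} :=
  measurableSet_lt measurable_const measurable_snd

theorem integrableOn_inv_poleDistSq_sq :
    IntegrableOn (fun q => (poleDistSq q ^ 2)⁻¹) {q : ℝ × ℝ | 0 < q.2} volume := by
  have hdom : Integrable (fun q : ℝ × ℝ => (1 + q.1 ^ 2)⁻¹ * (1 + q.2 ^ 2)⁻¹) volume :=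
    integrable_inv_one_add_sq.mul_prod integrable_inv_one_add_sq
  refine hdom.integrableOn.mono'
    ((differentiable_poleDistSq.continuous.measurable.pow_const 2).inv.aestronglyMeasurable) ?_
  refine (ae_restrict_iff' measurableSet_upperHalfPlane).2 (.of_forall fun q hq => ?_)
  have hy : 0 < q.2 := hq
  rw [Real.norm_of_nonneg (by positivity), ← mul_inv]
  refine inv_anti₀ (by positivity) ?_
  rw [sq (poleDistSq q)]
  simp only [poleDistSq]
  apply mul_le_mul _ _ (by positivity) (by positivity) <;> nlinarith [sq_nonneg q.1]

theorem setIntegral_inv_poleDistSq_sq_pos :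
    0 < ∫ q in {q : ℝ × ℝ | 0 < q.2}, (poleDistSq q ^ 2)⁻¹ := by
  rw [setIntegral_pos_iff_support_of_nonneg_ae (.of_forall fun q => by positivity)
    integrableOn_inv_poleDistSq_sq]
  have hsub : {q : ℝ × ℝ | 0 < q.2} ⊆ Function.support fun q => (poleDistSq q ^ 2)⁻¹ :=
    fun q hq => inv_ne_zero (pow_ne_zero 2 (poleDistSq_pos hq).ne')
  rw [Set.inter_eq_right.2 hsub]
  exact (isOpen_lt continuous_const continuous_snd).measure_pos volume ⟨(0, 1), one_pos (α := ℝ)⟩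

/-- On the upper half-plane `Ω = ℝ × (0, ∞)`, the function
`F(x, y) = x / (x² + (y + 1)²)` is smooth, harmonic, and its Dirichlet energy
`∫_Ω ((∂F/∂x)² + (∂F/∂y)²)` is finite and strictly positive (i.e. `dF` is a
nonzero `L²` harmonic 1-form on `ℍ²(−1)`). -/
theorem harmonic_L2_one_form_exists :
    ∀ (Ω : Set (ℝ × ℝ)) (F : ℝ × ℝ → ℝ),
      Ω = {q : ℝ × ℝ | 0 < q.2} →
      (∀ q : ℝ × ℝ, F q = q.1 / (q.1 ^ 2 + (q.2 + 1) ^ 2)) →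
      ContDiffOn ℝ (⊤ : ℕ∞) F Ω ∧
      (∀ q ∈ Ω, pdx (pdx F) q + pdy (pdy F) q = 0) ∧
      IntegrableOn (fun q : ℝ × ℝ => pdx F q ^ 2 + pdy F q ^ 2) Ω volume ∧
      0 < ∫ q in Ω, (pdx F q ^ 2 + pdy F q ^ 2) := by
  rintro Ω F rfl hF
  obtain rfl : F = fun p => p.1 / poleDistSq p := funext hF
  have henergy : Set.EqOn (fun q => (poleDistSq q ^ 2)⁻¹)
      (fun q => pdx (fun p => p.1 / poleDistSq p) q ^ 2 + pdy (fun p => p.1 / poleDistSq p) q ^ 2)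
      {q : ℝ × ℝ | 0 < q.2} :=
    fun q hq => (pdx_sq_add_pdy_sq_div_poleDistSq (poleDistSq_pos hq).ne').symm
  refine ⟨contDiff_fst.contDiffOn.fun_div contDiff_poleDistSq.contDiffOn
    fun q hq => (poleDistSq_pos hq).ne', fun q hq => ?_,
    integrableOn_inv_poleDistSq_sq.congr_fun henergy measurableSet_upperHalfPlane, ?_⟩
  · have hq' := (poleDistSq_pos hq).ne'
    rw [pdx_pdx_div_poleDistSq hq', pdy_pdy_div_poleDistSq hq']
    ring
  · rw [← setIntegral_congr_fun measurableSet_upperHalfPlane henergy]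
    exact setIntegral_inv_poleDistSq_sq_pos
end

section
/- Let Ω = ℝ × (0, ∞) and let F : Ω → ℝ be smooth and harmonic on Ω (∂²F/∂x² + ∂²F/∂y² = 0 on Ω). Suppose that both integrals ∫_Ω ((∂F/∂x)² + (∂F/∂y)²) dx dy and ∫_Ω y²·[ (F_{xx} − F_y/y)² + 2(F_{xy} + F_x/y)² + (F_{yy} + F_y/y)² ] dx dy are finite, where F_x, F_y denote first partials and F_{xx}, F_{xy}, F_{yy} second partials. Then the two integrals are equal: ∫_Ω y²·[ (F_{xx} − F_y/y)² + 2(F_{xy} + F_x/y)² + (F_{yy} + F_y/y)² ] dx dy = ∫_Ω ((∂F/∂x)² + (∂F/∂y)²) dx dy. -/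
open MeasureTheory

open Set Filter Topology

section PartialDerivatives

variable {f g : ℝ × ℝ → ℝ} {q : ℝ × ℝ}

lemma pdx_mul (hf : DifferentiableAt ℝ f q) (hg : DifferentiableAt ℝ g q) :
    pdx (fun p => f p * g p) q = f q * pdx g q + g q * pdx f q := by
  simp [pdx, fderiv_fun_mul hf hg]

lemma pdy_mul (hf : DifferentiableAt ℝ f q) (hg : DifferentiableAt ℝ g q) :
    pdy (fun p => f p * g p) q = f q * pdy g q + g q * pdy f q := by
  simp [pdy, fderiv_fun_mul hf hg]

lemma pdx_add (hf : DifferentiableAt ℝ f q) (hg : DifferentiableAt ℝ g q) :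
    pdx (fun p => f p + g p) q = pdx f q + pdx g q := by
  simp [pdx, fderiv_fun_add hf hg]

lemma pdy_add (hf : DifferentiableAt ℝ f q) (hg : DifferentiableAt ℝ g q) :
    pdy (fun p => f p + g p) q = pdy f q + pdy g q := by
  simp [pdy, fderiv_fun_add hf hg]

lemma pdx_comp_fst {h : ℝ → ℝ} {h' : ℝ} (hh : HasDerivAt h h' q.1) :
    pdx (fun p => h p.1) q = h' := by
  have := hh.comp_hasFDerivAt q (hasFDerivAt_fst (𝕜 := ℝ) (p := q))
  simp [pdx, show fderiv ℝ (fun p : ℝ × ℝ => h p.1) q = _ from this.fderiv]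

lemma pdy_comp_fst {h : ℝ → ℝ} {h' : ℝ} (hh : HasDerivAt h h' q.1) :
    pdy (fun p => h p.1) q = 0 := by
  have := hh.comp_hasFDerivAt q (hasFDerivAt_fst (𝕜 := ℝ) (p := q))
  simp [pdy, show fderiv ℝ (fun p : ℝ × ℝ => h p.1) q = _ from this.fderiv]

lemma pdx_comp_snd {h : ℝ → ℝ} {h' : ℝ} (hh : HasDerivAt h h' q.2) :
    pdx (fun p => h p.2) q = 0 := by
  have := hh.comp_hasFDerivAt q (hasFDerivAt_snd (𝕜 := ℝ) (p := q))
  simp [pdx, show fderiv ℝ (fun p : ℝ × ℝ => h p.2) q = _ from this.fderiv]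

lemma pdy_comp_snd {h : ℝ → ℝ} {h' : ℝ} (hh : HasDerivAt h h' q.2) :
    pdy (fun p => h p.2) q = h' := by
  have := hh.comp_hasFDerivAt q (hasFDerivAt_snd (𝕜 := ℝ) (p := q))
  simp [pdy, show fderiv ℝ (fun p : ℝ × ℝ => h p.2) q = _ from this.fderiv]

lemma Filter.EventuallyEq.pdx_eq_s8 (h : f =ᶠ[𝓝 q] g) : pdx f q = pdx g q := by
  simp [pdx, h.fderiv_eq]

lemma Filter.EventuallyEq.pdy_eq_s8 (h : f =ᶠ[𝓝 q] g) : pdy f q = pdy g q := by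
  simp [pdy, h.fderiv_eq]

lemma pdx_neg : pdx (fun p => -f p) q = -pdx f q := by
  simp [pdx]

lemma pdy_neg : pdy (fun p => -f p) q = -pdy f q := by
  simp [pdy]

lemma ContDiffOn.pdx_of_isOpen {m n : WithTop ℕ∞} {s : Set (ℝ × ℝ)} (hs : IsOpen s)
    (hf : ContDiffOn ℝ n f s) (hmn : m + 1 ≤ n) : ContDiffOn ℝ m (pdx f) s :=
  (hf.fderiv_of_isOpen hs hmn).clm_apply contDiffOn_const

lemma ContDiffOn.pdy_of_isOpen {m n : WithTop ℕ∞} {s : Set (ℝ × ℝ)} (hs : IsOpen s)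
    (hf : ContDiffOn ℝ n f s) (hmn : m + 1 ≤ n) : ContDiffOn ℝ m (pdy f) s :=
  (hf.fderiv_of_isOpen hs hmn).clm_apply contDiffOn_const

lemma ContDiffAt.pdx_pdy_comm (hf : ContDiffAt ℝ 2 f q) :
    pdx (pdy f) q = pdy (pdx f) q := by
  have hd : DifferentiableAt ℝ (fderiv ℝ f) q :=
    (hf.fderiv_right (m := 1) (by norm_num)).differentiableAt (by norm_num)
  have hsymm := hf.isSymmSndFDerivAt (by simp) (1, 0) (0, 1)
  have key (v w : ℝ × ℝ) :
      fderiv ℝ (fun p => fderiv ℝ f p v) q w = fderiv ℝ (fderiv ℝ f) q w v := by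
    rw [fderiv_clm_apply hd (differentiableAt_const v)]
    simp
  change fderiv ℝ (fun p => fderiv ℝ f p (0, 1)) q (1, 0)
    = fderiv ℝ (fun p => fderiv ℝ f p (1, 0)) q (0, 1)
  rw [key, key, hsymm]

end PartialDerivatives

lemma isOpen_upperHalfPlane : IsOpen {q : ℝ × ℝ | 0 < q.2} :=
  isOpen_lt continuous_const continuous_snd

/-- The cutoff supported in the box `[-R, R] × [exp (-n), exp n]`. -/
noncomputable def boxCutoff (R n : ℝ) (q : ℝ × ℝ) : ℝ :=
  (1 - (q.1 / R) ^ 2) * (1 - (Real.log q.2 / n) ^ 2)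

section BoxCutoff

variable {R n : ℝ} {q : ℝ × ℝ}

lemma hasDerivAt_one_sub_div_sq (R x : ℝ) :
    HasDerivAt (fun x : ℝ => 1 - (x / R) ^ 2) (-(2 * x / R ^ 2)) x := by
  have := (((hasDerivAt_id x).div_const R).pow 2).const_sub 1
  refine this.congr_deriv ?_
  simp
  ring

lemma hasDerivAt_one_sub_log_div_sq (n : ℝ) {y : ℝ} (hy : 0 < y) :
    HasDerivAt (fun y : ℝ => 1 - (Real.log y / n) ^ 2) (-(2 * Real.log y / n ^ 2 / y)) y := by
  have := (((Real.hasDerivAt_log hy.ne').div_const n).pow 2).const_sub 1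
  refine this.congr_deriv ?_
  simp
  ring

lemma pdx_boxCutoff (hq : 0 < q.2) :
    pdx (boxCutoff R n) q = -(2 * q.1 / R ^ 2) * (1 - (Real.log q.2 / n) ^ 2) := by
  have h₁ := hasDerivAt_one_sub_div_sq R q.1
  have h₂ := hasDerivAt_one_sub_log_div_sq n hq
  have d₁ : DifferentiableAt ℝ (fun p : ℝ × ℝ => 1 - (p.1 / R) ^ 2) q :=
    h₁.differentiableAt.comp q differentiableAt_fst
  have d₂ : DifferentiableAt ℝ (fun p : ℝ × ℝ => 1 - (Real.log p.2 / n) ^ 2) q :=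
    h₂.differentiableAt.comp q differentiableAt_snd
  unfold boxCutoff
  rw [pdx_mul d₁ d₂, pdx_comp_fst h₁, pdx_comp_snd h₂]
  ring

lemma pdy_boxCutoff (hq : 0 < q.2) :
    pdy (boxCutoff R n) q = -(2 * Real.log q.2 / n ^ 2 / q.2) * (1 - (q.1 / R) ^ 2) := by
  have h₁ := hasDerivAt_one_sub_div_sq R q.1
  have h₂ := hasDerivAt_one_sub_log_div_sq n hq
  have d₁ : DifferentiableAt ℝ (fun p : ℝ × ℝ => 1 - (p.1 / R) ^ 2) q :=
    h₁.differentiableAt.comp q differentiableAt_fst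
  have d₂ : DifferentiableAt ℝ (fun p : ℝ × ℝ => 1 - (Real.log p.2 / n) ^ 2) q :=
    h₂.differentiableAt.comp q differentiableAt_snd
  unfold boxCutoff
  rw [pdy_mul d₁ d₂, pdy_comp_fst h₁, pdy_comp_snd h₂]
  ring

lemma contDiffOn_boxCutoff : ContDiffOn ℝ 1 (boxCutoff R n) {q : ℝ × ℝ | 0 < q.2} := by
  have hlog : ContDiffOn ℝ 1 (fun q : ℝ × ℝ => Real.log q.2) {q : ℝ × ℝ | 0 < q.2} :=
    contDiff_snd.contDiffOn.log fun q hq => (ne_of_gt hq)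
  unfold boxCutoff
  fun_prop

lemma sq_div_le_one {a b : ℝ} (hb : 0 < b) (h : |a| ≤ b) : (a / b) ^ 2 ≤ 1 := by
  rw [sq_le_one_iff_abs_le_one, abs_div, abs_of_pos hb]
  exact (div_le_one hb).2 h

lemma abs_log_le_of_mem_Icc (hq : q.2 ∈ Icc (Real.exp (-n)) (Real.exp n)) :
    |Real.log q.2| ≤ n := by
  have hpos : 0 < q.2 := (Real.exp_pos _).trans_le hq.1
  exact abs_le.2 ⟨(Real.le_log_iff_exp_le hpos).2 hq.1, (Real.log_le_iff_le_exp hpos).2 hq.2⟩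

lemma abs_one_sub_le_one {t : ℝ} (h0 : 0 ≤ t) (h1 : t ≤ 1) : |1 - t| ≤ 1 :=
  abs_le.2 ⟨by linarith, by linarith⟩

lemma abs_boxCutoff_le_one (hR : 0 < R) (hn : 0 < n)
    (hx : |q.1| ≤ R) (hy : q.2 ∈ Icc (Real.exp (-n)) (Real.exp n)) :
    |boxCutoff R n q| ≤ 1 := by
  rw [boxCutoff, abs_mul]
  exact mul_le_one₀ (abs_one_sub_le_one (sq_nonneg _) (sq_div_le_one hR hx)) (abs_nonneg _)
    (abs_one_sub_le_one (sq_nonneg _) (sq_div_le_one hn (abs_log_le_of_mem_Icc hy)))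

lemma snd_mul_abs_pdx_boxCutoff_le (hn : 0 < n) (hR : R = n * Real.exp n)
    (hx : |q.1| ≤ R) (hy : q.2 ∈ Icc (Real.exp (-n)) (Real.exp n)) :
    q.2 * |pdx (boxCutoff R n) q| ≤ 2 / n := by
  have hpos : 0 < q.2 := (Real.exp_pos _).trans_le hy.1
  have hR0 : 0 < R := hR ▸ by positivity
  rw [pdx_boxCutoff hpos, abs_mul, abs_neg, abs_div, abs_mul, abs_two,
    abs_of_pos (pow_pos hR0 2)]
  have h₁ := abs_one_sub_le_one (sq_nonneg _) (sq_div_le_one hn (abs_log_le_of_mem_Icc hy))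
  calc q.2 * (2 * |q.1| / R ^ 2 * |1 - (Real.log q.2 / n) ^ 2|)
      ≤ Real.exp n * (2 * R / R ^ 2 * 1) := by
        gcongr
        exact hy.2
    _ = 2 / n := by
        rw [hR]
        field_simp

lemma snd_mul_abs_pdy_boxCutoff_le (hn : 0 < n) (hR : 0 < R)
    (hx : |q.1| ≤ R) (hy : q.2 ∈ Icc (Real.exp (-n)) (Real.exp n)) :
    q.2 * |pdy (boxCutoff R n) q| ≤ 2 / n := by
  have hpos : 0 < q.2 := (Real.exp_pos _).trans_le hy.1
  rw [pdy_boxCutoff hpos, abs_mul, abs_neg, abs_div, abs_div, abs_mul, abs_two,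
    abs_of_pos (pow_pos hn 2), abs_of_pos hpos]
  have h₁ := abs_one_sub_le_one (sq_nonneg _) (sq_div_le_one hR hx)
  have h₂ := abs_log_le_of_mem_Icc hy
  calc q.2 * (2 * |Real.log q.2| / n ^ 2 / q.2 * |1 - (q.1 / R) ^ 2|)
      ≤ q.2 * (2 * n / n ^ 2 / q.2 * 1) := by gcongr
    _ = 2 / n := by field_simp

end BoxCutoff

/-- The divergence theorem on a box inside the upper half-plane, tested against `boxCutoff`. -/
lemma setIntegral_divergence_boxCutoff_mul {X Y : ℝ × ℝ → ℝ} {R n : ℝ} (hR : 0 < R) (hn : 0 < n)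
    (hX : ContDiffOn ℝ 1 X {q : ℝ × ℝ | 0 < q.2}) (hY : ContDiffOn ℝ 1 Y {q : ℝ × ℝ | 0 < q.2}) :
    ∫ q in Icc (-R, Real.exp (-n)) (R, Real.exp n),
      (boxCutoff R n q * (pdx X q + pdy Y q)
        + (X q * pdx (boxCutoff R n) q + Y q * pdy (boxCutoff R n) q)) = 0 := by
  set B : Set (ℝ × ℝ) := Icc (-R, Real.exp (-n)) (R, Real.exp n)
  have hBΩ : B ⊆ {q : ℝ × ℝ | 0 < q.2} := fun q hq => (Real.exp_pos _).trans_le hq.1.2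
  have hφ := contDiffOn_boxCutoff (R := R) (n := n)
  have hdiff {f : ℝ × ℝ → ℝ} (hf : ContDiffOn ℝ 1 f {q : ℝ × ℝ | 0 < q.2}) {q : ℝ × ℝ}
      (hq : 0 < q.2) : DifferentiableAt ℝ f q :=
    (hf.contDiffAt (isOpen_upperHalfPlane.mem_nhds hq)).differentiableAt (by norm_num)
  have hφX := hφ.mul hX
  have hφY := hφ.mul hY
  have hIoo : ∀ q ∈ Ioo (-R) R ×ˢ Ioo (Real.exp (-n)) (Real.exp n), (0 : ℝ) < q.2 :=
    fun q hq => (Real.exp_pos _).trans hq.2.1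
  have hle : ((-R, Real.exp (-n)) : ℝ × ℝ) ≤ (R, Real.exp n) :=
    ⟨by linarith, Real.exp_le_exp.2 (by linarith)⟩
  have hcont : ContinuousOn (fun q =>
      pdx (fun p => boxCutoff R n p * X p) q + pdy (fun p => boxCutoff R n p * Y p) q) B :=
    (((hφX.pdx_of_isOpen isOpen_upperHalfPlane (m := 0) (by norm_num)).continuousOn).add
      ((hφY.pdy_of_isOpen isOpen_upperHalfPlane (m := 0) (by norm_num)).continuousOn)).mono hBΩ
  have key := integral_divergence_prod_Icc_of_hasFDerivAt_of_le
    (fun p => boxCutoff R n p * X p) (fun p => boxCutoff R n p * Y p)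
    (fderiv ℝ (fun p => boxCutoff R n p * X p)) (fderiv ℝ (fun p => boxCutoff R n p * Y p))
    (-R, Real.exp (-n)) (R, Real.exp n) hle
    (hφX.continuousOn.mono hBΩ) (hφY.continuousOn.mono hBΩ)
    (fun q hq => (hdiff hφX (hIoo q hq)).hasFDerivAt)
    (fun q hq => (hdiff hφY (hIoo q hq)).hasFDerivAt)
    (hcont.integrableOn_compact isCompact_Icc)
  have hb : ∫ q in B, (pdx (fun p => boxCutoff R n p * X p) q
      + pdy (fun p => boxCutoff R n p * Y p) q) = 0 := by
    refine key.trans ?_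
    simp [boxCutoff, hn.ne', hR.ne']
  rw [← hb]
  refine setIntegral_congr_fun measurableSet_Icc fun q hq => ?_
  have hq' : 0 < q.2 := hBΩ hq
  rw [pdx_mul (hdiff hφ hq') (hdiff hX hq'), pdy_mul (hdiff hφ hq') (hdiff hY hq')]
  ring

/-- Gaffney's form of the divergence theorem in the hyperbolic upper half-plane: a `C¹` vector
field with integrable hyperbolic length and integrable divergence has vanishing total
divergence. -/
theorem setIntegral_divergence_eq_zero_of_integrable {X Y w : ℝ × ℝ → ℝ}
    (hX : ContDiffOn ℝ 1 X {q : ℝ × ℝ | 0 < q.2}) (hY : ContDiffOn ℝ 1 Y {q : ℝ × ℝ | 0 < q.2})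
    (hw : IntegrableOn w {q : ℝ × ℝ | 0 < q.2})
    (hXw : ∀ q : ℝ × ℝ, 0 < q.2 → |X q| ≤ q.2 * w q)
    (hYw : ∀ q : ℝ × ℝ, 0 < q.2 → |Y q| ≤ q.2 * w q)
    (hD : IntegrableOn (fun q => pdx X q + pdy Y q) {q : ℝ × ℝ | 0 < q.2}) :
    ∫ q in {q : ℝ × ℝ | 0 < q.2}, (pdx X q + pdy Y q) = 0 := by
  set Ω : Set (ℝ × ℝ) := {q : ℝ × ℝ | 0 < q.2}
  have hΩm : MeasurableSet Ω := isOpen_upperHalfPlane.measurableSet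
  set R : ℕ → ℝ := fun k => ((k : ℝ) + 1) * Real.exp ((k : ℝ) + 1)
  set φ : ℕ → ℝ × ℝ → ℝ := fun k => boxCutoff (R k) ((k : ℝ) + 1) with hφdef
  set B : ℕ → Set (ℝ × ℝ) := fun k =>
    Icc (-R k, Real.exp (-((k : ℝ) + 1))) (R k, Real.exp ((k : ℝ) + 1))
  have hn (k : ℕ) : (0 : ℝ) < (k : ℝ) + 1 := by positivity
  have hR (k : ℕ) : 0 < R k := mul_pos (hn k) (Real.exp_pos _)
  have hBm (k : ℕ) : MeasurableSet (B k) := measurableSet_Icc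
  have hBΩ (k : ℕ) : B k ⊆ Ω := fun q hq => (Real.exp_pos _).trans_le hq.1.2
  have hBx {k : ℕ} {q : ℝ × ℝ} (hq : q ∈ B k) : |q.1| ≤ R k := abs_le.2 ⟨hq.1.1, hq.2.1⟩
  have hBy {k : ℕ} {q : ℝ × ℝ} (hq : q ∈ B k) :
      q.2 ∈ Icc (Real.exp (-((k : ℝ) + 1))) (Real.exp ((k : ℝ) + 1)) := ⟨hq.1.2, hq.2.2⟩
  have hφc (k : ℕ) : ContDiffOn ℝ 1 (φ k) Ω := contDiffOn_boxCutoff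
  have hDc : ContinuousOn (fun q => pdx X q + pdy Y q) Ω :=
    (hX.pdx_of_isOpen isOpen_upperHalfPlane (m := 0) (by norm_num)).continuousOn.add
      (hY.pdy_of_isOpen isOpen_upperHalfPlane (m := 0) (by norm_num)).continuousOn
  have hEc (k : ℕ) : ContinuousOn (fun q => X q * pdx (φ k) q + Y q * pdy (φ k) q) Ω :=
    (hX.continuousOn.mul
      ((hφc k).pdx_of_isOpen isOpen_upperHalfPlane (m := 0) (by norm_num)).continuousOn).add
      (hY.continuousOn.mul
        ((hφc k).pdy_of_isOpen isOpen_upperHalfPlane (m := 0) (by norm_num)).continuousOn)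
  have hφD (k : ℕ) : ContinuousOn (fun q => φ k q * (pdx X q + pdy Y q)) Ω :=
    (hφc k).continuousOn.mul hDc
  have hsplit (k : ℕ) : ∫ q in B k, φ k q * (pdx X q + pdy Y q)
      = -∫ q in B k, (X q * pdx (φ k) q + Y q * pdy (φ k) q) := by
    have h := setIntegral_divergence_boxCutoff_mul (hR k) (hn k) hX hY
    rw [integral_add (((hφD k).mono (hBΩ k)).integrableOn_compact isCompact_Icc)
      (((hEc k).mono (hBΩ k)).integrableOn_compact isCompact_Icc)] at h
    exact eq_neg_of_add_eq_zero_left h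
  have hw0 : ∀ q ∈ Ω, 0 ≤ w q := fun q hq =>
    nonneg_of_mul_nonneg_right ((abs_nonneg _).trans (hXw q hq)) hq
  have hbound (k : ℕ) : ‖∫ q in B k, φ k q * (pdx X q + pdy Y q)‖
      ≤ 4 / ((k : ℝ) + 1) * ∫ q in Ω, w q := by
    rw [hsplit, norm_neg]
    calc ‖∫ q in B k, (X q * pdx (φ k) q + Y q * pdy (φ k) q)‖
        ≤ ∫ q in B k, 4 / ((k : ℝ) + 1) * w q := by
          refine norm_integral_le_of_norm_le ((hw.mono_set (hBΩ k)).const_mul _) ?_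
          refine (ae_restrict_iff' (hBm k)).2 (Eventually.of_forall fun q hq => ?_)
          have hq0 : 0 < q.2 := hBΩ k hq
          have hwq := hw0 q hq0
          have h₁ := snd_mul_abs_pdx_boxCutoff_le (hn k) rfl (hBx hq) (hBy hq)
          have h₂ := snd_mul_abs_pdy_boxCutoff_le (hn k) (hR k) (hBx hq) (hBy hq)
          calc ‖X q * pdx (φ k) q + Y q * pdy (φ k) q‖
              ≤ |X q| * |pdx (φ k) q| + |Y q| * |pdy (φ k) q| := by
                rw [Real.norm_eq_abs, ← abs_mul, ← abs_mul]
                exact abs_add_le _ _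
            _ ≤ q.2 * w q * |pdx (φ k) q| + q.2 * w q * |pdy (φ k) q| := by
                gcongr
                · exact hXw q hq0
                · exact hYw q hq0
            _ = (q.2 * |pdx (φ k) q| + q.2 * |pdy (φ k) q|) * w q := by ring
            _ ≤ (2 / ((k : ℝ) + 1) + 2 / ((k : ℝ) + 1)) * w q := by gcongr
            _ = 4 / ((k : ℝ) + 1) * w q := by ring
      _ = 4 / ((k : ℝ) + 1) * ∫ q in B k, w q := integral_const_mul _ _
      _ ≤ 4 / ((k : ℝ) + 1) * ∫ q in Ω, w q := by
          refine mul_le_mul_of_nonneg_left ?_ (by positivity)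
          exact setIntegral_mono_set hw ((ae_restrict_iff' hΩm).2 (Eventually.of_forall hw0))
            (hBΩ k).eventuallyLE
  have hkinf : Tendsto (fun k : ℕ => (k : ℝ) + 1) atTop atTop :=
    tendsto_atTop_add_const_right _ _ tendsto_natCast_atTop_atTop
  have hRinf : Tendsto R atTop atTop :=
    hkinf.atTop_mul_atTop₀ (Real.tendsto_exp_atTop.comp hkinf)
  have hlim0 : Tendsto (fun k => ∫ q in B k, φ k q * (pdx X q + pdy Y q)) atTop (𝓝 0) := by
    refine squeeze_zero_norm hbound ?_
    simpa using (hkinf.const_div_atTop 4).mul_const (∫ q in Ω, w q)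
  have hind (k : ℕ) : ∫ q in B k, φ k q * (pdx X q + pdy Y q)
      = ∫ q in Ω, (B k).indicator (fun q => φ k q * (pdx X q + pdy Y q)) q := by
    rw [setIntegral_indicator (hBm k), inter_eq_self_of_subset_right (hBΩ k)]
  have hlimD : Tendsto (fun k => ∫ q in B k, φ k q * (pdx X q + pdy Y q)) atTop
      (𝓝 (∫ q in Ω, (pdx X q + pdy Y q))) := by
    simp_rw [hind]
    refine tendsto_integral_of_dominated_convergence (fun q => ‖pdx X q + pdy Y q‖)
      (fun k => ((hφD k).aestronglyMeasurable hΩm).indicator (hBm k)) hD.norm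
      (fun k => Eventually.of_forall fun q => ?_)
      ((ae_restrict_iff' hΩm).2 (Eventually.of_forall fun q hq => ?_))
    · by_cases hq : q ∈ B k
      · rw [indicator_of_mem hq, norm_mul]
        exact mul_le_of_le_one_left (norm_nonneg _)
          (abs_boxCutoff_le_one (hR k) (hn k) (hBx hq) (hBy hq))
      · simp [indicator_of_notMem hq]
    · have hq0 : 0 < q.2 := hq
      have hmem : ∀ᶠ k in atTop, q ∈ B k := by
        filter_upwards [hRinf.eventually_ge_atTop |q.1|,
          hkinf.eventually_ge_atTop |Real.log q.2|] with k h₁ h₂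
        exact ⟨⟨(abs_le.1 h₁).1, (Real.le_log_iff_exp_le hq0).1 (abs_le.1 h₂).1⟩,
          ⟨(abs_le.1 h₁).2, (Real.log_le_iff_le_exp hq0).1 (abs_le.1 h₂).2⟩⟩
      have hφ1 : Tendsto (fun k => φ k q) atTop (𝓝 1) := by
        have h₁ := ((hRinf.const_div_atTop q.1).pow 2).const_sub 1
        have h₂ := ((hkinf.const_div_atTop (Real.log q.2)).pow 2).const_sub 1
        simpa [hφdef, boxCutoff] using h₁.mul h₂
      have hlim := hφ1.mul_const (pdx X q + pdy Y q)
      rw [one_mul] at hlim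
      refine hlim.congr' ?_
      filter_upwards [hmem] with k hk
      rw [indicator_of_mem hk]
  exact tendsto_nhds_unique hlimD hlim0

/-- The Bochner identity for a pair `u, v` with `u_x = -v_y` and `u_y = v_x`, in divergence form:
the hyperbolic `|∇ω|² - |ω|²` of `ω = u dx + v dy` is a divergence. -/
lemma bochner_divergence_identity {Ω : Set (ℝ × ℝ)} (hΩ : IsOpen Ω) {u v : ℝ × ℝ → ℝ}
    (hu : ContDiffOn ℝ 2 u Ω) (hv : ContDiffOn ℝ 2 v Ω)
    (hdiv : ∀ q ∈ Ω, pdx u q = -pdy v q) (hcurl : ∀ q ∈ Ω, pdy u q = pdx v q)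
    {q : ℝ × ℝ} (hq : q ∈ Ω) (hy : q.2 ≠ 0) :
    pdx (fun p => p.2 ^ 2 * (u p * pdx u p + v p * pdx v p)) q
      + pdy (fun p => p.2 ^ 2 * (u p * pdy u p + v p * pdy v p)
          + p.2 * (u p * u p + v p * v p)) q
    = q.2 ^ 2 * ((pdx u q - v q / q.2) ^ 2 + 2 * (pdy u q + u q / q.2) ^ 2
        + (pdy v q + v q / q.2) ^ 2) - (u q ^ 2 + v q ^ 2) := by
  have hnhds : Ω ∈ 𝓝 q := hΩ.mem_nhds hq
  have hd {f : ℝ × ℝ → ℝ} (hf : ContDiffOn ℝ 1 f Ω) : DifferentiableAt ℝ f q :=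
    (hf.contDiffAt hnhds).differentiableAt (by norm_num)
  have du := hd (hu.of_le (by norm_num))
  have dv := hd (hv.of_le (by norm_num))
  have dux := hd (hu.pdx_of_isOpen hΩ (by norm_num))
  have duy := hd (hu.pdy_of_isOpen hΩ (by norm_num))
  have dvx := hd (hv.pdx_of_isOpen hΩ (by norm_num))
  have dvy := hd (hv.pdy_of_isOpen hΩ (by norm_num))
  have d₁ : DifferentiableAt ℝ (fun p : ℝ × ℝ => p.2) q := differentiableAt_snd
  have d₂ : DifferentiableAt ℝ (fun p : ℝ × ℝ => p.2 ^ 2) q := by fun_prop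
  have ex₂ : pdx (fun p : ℝ × ℝ => p.2 ^ 2) q = 0 := pdx_comp_snd (hasDerivAt_pow 2 q.2)
  have ey₂ : pdy (fun p : ℝ × ℝ => p.2 ^ 2) q = 2 * q.2 := by
    simpa using pdy_comp_snd (hasDerivAt_pow 2 q.2)
  have ey₁ : pdy (fun p : ℝ × ℝ => p.2) q = 1 := pdy_comp_snd (hasDerivAt_id q.2)
  have hcu : pdx (pdy u) q = pdy (pdx u) q := (hu.contDiffAt hnhds).pdx_pdy_comm
  have hcv : pdx (pdy v) q = pdy (pdx v) q := (hv.contDiffAt hnhds).pdx_pdy_comm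
  have e₁ : pdx (pdx u) q = -pdx (pdy v) q := by
    rw [← pdx_neg]
    exact EventuallyEq.pdx_eq_s8 (eventually_of_mem hnhds hdiv)
  have e₂ : pdy (pdy u) q = pdy (pdx v) q :=
    EventuallyEq.pdy_eq_s8 (eventually_of_mem hnhds hcurl)
  have e₃ : pdx (pdx v) q = pdx (pdy u) q :=
    (EventuallyEq.pdx_eq_s8 (eventually_of_mem hnhds hcurl)).symm
  have e₄ : pdy (pdx u) q = -pdy (pdy v) q := by
    rw [← pdy_neg]
    exact EventuallyEq.pdy_eq_s8 (eventually_of_mem hnhds hdiv)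
  rw [pdx_mul d₂ ((du.fun_mul dux).fun_add (dv.fun_mul dvx)), pdx_add (du.fun_mul dux) (dv.fun_mul dvx),
    pdx_mul du dux, pdx_mul dv dvx,
    pdy_add (d₂.fun_mul ((du.fun_mul duy).fun_add (dv.fun_mul dvy))) (d₁.fun_mul ((du.fun_mul du).fun_add (dv.fun_mul dv))),
    pdy_mul d₂ ((du.fun_mul duy).fun_add (dv.fun_mul dvy)), pdy_add (du.fun_mul duy) (dv.fun_mul dvy),
    pdy_mul du duy, pdy_mul dv dvy, pdy_mul d₁ ((du.fun_mul du).fun_add (dv.fun_mul dv)),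
    pdy_add (du.fun_mul du) (dv.fun_mul dv), pdy_mul du du, pdy_mul dv dv, ex₂, ey₂, ey₁,
    e₁, e₂, e₃, hcu, hcv, e₄, hdiv q hq, hcurl q hq]
  field_simp
  ring

lemma abs_mul_add_mul_le (a b c d : ℝ) :
    |a * b + c * d| ≤ (a ^ 2 + c ^ 2) + (b ^ 2 + d ^ 2) :=
  abs_le.2 ⟨by nlinarith [sq_nonneg (a + b), sq_nonneg (c + d), sq_nonneg a, sq_nonneg b,
      sq_nonneg c, sq_nonneg d],
    by nlinarith [sq_nonneg (a - b), sq_nonneg (c - d), sq_nonneg a, sq_nonneg b,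
      sq_nonneg c, sq_nonneg d]⟩

/-- For a smooth harmonic function `F` on the upper half-plane `Ω = ℝ × (0, ∞)`,
if both `∫_Ω (F_x² + F_y²)` and
`∫_Ω y² [(F_{xx} − F_y/y)² + 2(F_{xy} + F_x/y)² + (F_{yy} + F_y/y)²]` are finite,
then they are equal.  (This is `‖∇(dF)‖²_{L²(ℍ²(−1))} = ‖dF‖²_{L²(ℍ²(−1))}`.) -/
theorem covariant_deriv_eq_L2_norm_harmonic
    (Ω : Set (ℝ × ℝ)) (hΩ : Ω = {q : ℝ × ℝ | 0 < q.2})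
    (F : ℝ × ℝ → ℝ) (hF : ContDiffOn ℝ (⊤ : ℕ∞) F Ω)
    (hharm : ∀ q ∈ Ω, pdx (pdx F) q + pdy (pdy F) q = 0)
    (h1 : IntegrableOn (fun q : ℝ × ℝ => pdx F q ^ 2 + pdy F q ^ 2) Ω volume)
    (h2 : IntegrableOn (fun q : ℝ × ℝ =>
      q.2 ^ 2 * ((pdx (pdx F) q - pdy F q / q.2) ^ 2
        + 2 * (pdy (pdx F) q + pdx F q / q.2) ^ 2
        + (pdy (pdy F) q + pdy F q / q.2) ^ 2)) Ω volume) :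
    (∫ q in Ω, q.2 ^ 2 * ((pdx (pdx F) q - pdy F q / q.2) ^ 2
        + 2 * (pdy (pdx F) q + pdx F q / q.2) ^ 2
        + (pdy (pdy F) q + pdy F q / q.2) ^ 2))
      = ∫ q in Ω, (pdx F q ^ 2 + pdy F q ^ 2) := by
  subst hΩ
  have hΩo := isOpen_upperHalfPlane
  have hF3 : ContDiffOn ℝ 3 F {q : ℝ × ℝ | 0 < q.2} := contDiffOn_infty.1 hF 3
  have hu : ContDiffOn ℝ 2 (pdx F) {q : ℝ × ℝ | 0 < q.2} :=
    hF3.pdx_of_isOpen hΩo (by norm_num)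
  have hv : ContDiffOn ℝ 2 (pdy F) {q : ℝ × ℝ | 0 < q.2} :=
    hF3.pdy_of_isOpen hΩo (by norm_num)
  have hdiv : ∀ q ∈ {q : ℝ × ℝ | 0 < q.2}, pdx (pdx F) q = -pdy (pdy F) q :=
    fun q hq => eq_neg_of_add_eq_zero_left (hharm q hq)
  have hcurl : ∀ q ∈ {q : ℝ × ℝ | 0 < q.2}, pdy (pdx F) q = pdx (pdy F) q := fun q hq =>
    (((hF3.contDiffAt (hΩo.mem_nhds hq)).of_le (by norm_num)).pdx_pdy_comm).symm
  have hident : EqOn _ _ {q : ℝ × ℝ | 0 < q.2} := fun q hq =>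
    bochner_divergence_identity hΩo hu hv hdiv hcurl hq (ne_of_gt hq)
  have hux : ContDiffOn ℝ 1 (pdx (pdx F)) {q : ℝ × ℝ | 0 < q.2} := hu.pdx_of_isOpen hΩo (by norm_num)
  have huy : ContDiffOn ℝ 1 (pdy (pdx F)) {q : ℝ × ℝ | 0 < q.2} := hu.pdy_of_isOpen hΩo (by norm_num)
  have hvx : ContDiffOn ℝ 1 (pdx (pdy F)) {q : ℝ × ℝ | 0 < q.2} := hv.pdx_of_isOpen hΩo (by norm_num)
  have hvy : ContDiffOn ℝ 1 (pdy (pdy F)) {q : ℝ × ℝ | 0 < q.2} := hv.pdy_of_isOpen hΩo (by norm_num)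
  have hu1 : ContDiffOn ℝ 1 (pdx F) {q : ℝ × ℝ | 0 < q.2} := hu.of_le (by norm_num)
  have hv1 : ContDiffOn ℝ 1 (pdy F) {q : ℝ × ℝ | 0 < q.2} := hv.of_le (by norm_num)
  have hnorm {q : ℝ × ℝ} (hq : 0 < q.2) :
      q.2 ^ 2 * ((pdx (pdx F) q - pdy F q / q.2) ^ 2 + 2 * (pdy (pdx F) q + pdx F q / q.2) ^ 2
        + (pdy (pdy F) q + pdy F q / q.2) ^ 2)
      = 2 * ((q.2 * pdx (pdx F) q - pdy F q) ^ 2 + (q.2 * pdy (pdx F) q + pdx F q) ^ 2) := by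
    have hvy' : pdy (pdy F) q = -pdx (pdx F) q := by rw [hdiv q hq, neg_neg]
    rw [hvy']
    field_simp
    ring
  have h0 := setIntegral_divergence_eq_zero_of_integrable
    (X := fun p => p.2 ^ 2 * (pdx F p * pdx (pdx F) p + pdy F p * pdx (pdy F) p))
    (Y := fun p => p.2 ^ 2 * (pdx F p * pdy (pdx F) p + pdy F p * pdy (pdy F) p)
      + p.2 * (pdx F p * pdx F p + pdy F p * pdy F p))
    (by fun_prop) (by fun_prop) (h1.add h2) (fun q hq => ?_) (fun q hq => ?_)
    ((h2.sub h1).congr_fun hident.symm hΩo.measurableSet)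
  · rw [setIntegral_congr_fun hΩo.measurableSet hident, integral_sub h2 h1] at h0
    exact sub_eq_zero.1 h0
  · rw [Pi.add_apply, hnorm hq, ← hcurl q hq]
    set u := pdx F q
    set v := pdy F q
    set a := pdx (pdx F) q
    set b := pdy (pdx F) q
    have key := abs_mul_add_mul_le u (q.2 * a - v) v (q.2 * b + u)
    rw [show q.2 ^ 2 * (u * a + v * b) = q.2 * (u * (q.2 * a - v) + v * (q.2 * b + u)) by ring,
      abs_mul, abs_of_pos hq]
    gcongr
    nlinarith [sq_nonneg (q.2 * a - v), sq_nonneg (q.2 * b + u)]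
  · have hvy' : pdy (pdy F) q = -pdx (pdx F) q := by rw [hdiv q hq, neg_neg]
    rw [Pi.add_apply, hnorm hq, hvy']
    set u := pdx F q
    set v := pdy F q
    set a := pdx (pdx F) q
    set b := pdy (pdx F) q
    have key := abs_mul_add_mul_le u (q.2 * b + u) v (-(q.2 * a - v))
    rw [show q.2 ^ 2 * (u * b + v * -a) + q.2 * (u * u + v * v)
        = q.2 * (u * (q.2 * b + u) + v * -(q.2 * a - v)) + 0 by ring, add_zero,
      abs_mul, abs_of_pos hq]
    gcongr
    nlinarith [sq_nonneg (q.2 * a - v), sq_nonneg (q.2 * b + u)]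
end
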